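/- Let F be a finite field with exactly q elements, let n ≥ 2, and let H be a subgroup of GL(n,F) containing SL(n,F) (that is, containing every invertible matrix of determinant 1). Let j denote the index of H in GL(n,F). Then q^{n−1}(q−1)/j ≤ k(H), k(H) ≤ (q−1) · k(SL(n,F))/j, and (q−1) · k(SL(n,F)) ≤ q^n + 3 · q^{n−1}. -/

import Mathlib

open Polynomial

/-- Bounding a union of subgroups fibrewise by its intersection with a fixed subgroup. -/
theorem Subgroup.card_sigma_le {G ι : Type*} [Group G] [Finite G] [Finite ι] (H : Subgroup G)
    (s : ι → Subgroup G) :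
    Nat.card {p : ι × G // p.2 ∈ s p.1} ≤
      H.index * Nat.card {p : ι × H // (p.2 : G) ∈ s p.1} := by
  have := Fintype.ofFinite ι
  have e₁ : {p : ι × G // p.2 ∈ s p.1} ≃ Σ i, {g : G // g ∈ s i} :=
    ⟨fun p => ⟨p.1.1, p.1.2, p.2⟩, fun p => ⟨(p.1, p.2.1), p.2.2⟩, fun _ => rfl, fun _ => rfl⟩
  have e₂ : {p : ι × H // (p.2 : G) ∈ s p.1} ≃ Σ i, {h : H // h ∈ (s i).subgroupOf H} :=
    ⟨fun p => ⟨p.1.1, p.1.2, p.2⟩, fun p => ⟨(p.1, p.2.1), p.2.2⟩, fun _ => rfl, fun _ => rfl⟩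
  rw [Nat.card_congr e₁, Nat.card_congr e₂, Nat.card_sigma, Nat.card_sigma, Finset.mul_sum]
  refine Finset.sum_le_sum fun i _ => ?_
  have h₁ := (H.subgroupOf (s i)).index_mul_card
  have h₂ : H.relIndex (s i) ≤ H.index :=
    H.relIndex_top_right ▸ Subgroup.relIndex_le_of_le_right le_top
      (by rw [H.relIndex_top_right]; exact H.index_ne_zero_of_finite)
  have e₃ : H.subgroupOf (s i) ≃ (s i).subgroupOf H :=
    ⟨fun x => ⟨⟨x.1.1, x.2⟩, x.1.2⟩, fun x => ⟨⟨x.1.1, x.2⟩, x.1.2⟩, fun _ => rfl, fun _ => rfl⟩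
  calc Nat.card (s i) = H.relIndex (s i) * Nat.card (H.subgroupOf (s i)) := h₁.symm
    _ = H.relIndex (s i) * Nat.card ((s i).subgroupOf H) := by rw [Nat.card_congr e₃]
    _ ≤ _ := Nat.mul_le_mul_right _ h₂

/-- The commuting probability of a subgroup is at least that of the group. -/
theorem Subgroup.commProb_le_commProb {G : Type*} [Group G] [Finite G] (H : Subgroup G) :
    commProb G ≤ commProb H := by
  have h₁ := H.card_sigma_le (fun g : G => Subgroup.centralizer {g})
  have h₂ := H.card_sigma_le (fun h : H => Subgroup.centralizer {(h : G)})
  have e₁ : {p : G × G // p.2 ∈ Subgroup.centralizer {p.1}} ≃ {p : G × G // Commute p.1 p.2} :=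
    Equiv.subtypeEquivRight fun p => by
      rw [Subgroup.mem_centralizer_singleton_iff]; exact eq_comm
  have e₂ : {p : G × H // (p.2 : G) ∈ Subgroup.centralizer {p.1}} ≃
      {p : H × G // p.2 ∈ Subgroup.centralizer {(p.1 : G)}} :=
    (Equiv.prodComm G H).subtypeEquiv fun p => by
      simp [Subgroup.mem_centralizer_singleton_iff, eq_comm]
  have e₃ : {p : H × H // (p.2 : G) ∈ Subgroup.centralizer {(p.1 : G)}} ≃
      {p : H × H // Commute p.1 p.2} :=
    Equiv.subtypeEquivRight fun p => by
      rw [Subgroup.mem_centralizer_singleton_iff, Commute, SemiconjBy, Subtype.ext_iff]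
      exact eq_comm
  rw [Nat.card_congr e₁, Nat.card_congr e₂] at h₁
  rw [Nat.card_congr e₃] at h₂
  have h₃ := h₁.trans (Nat.mul_le_mul_left _ h₂)
  have hH : (0 : ℚ) < Nat.card H := Nat.cast_pos.mpr Finite.card_pos
  have hi : (0 : ℚ) < H.index := Nat.cast_pos.mpr (Nat.pos_of_ne_zero H.index_ne_zero_of_finite)
  rw [commProb_def, commProb_def, ← H.card_mul_index, Nat.cast_mul,
    div_le_div_iff₀ (by positivity) (by positivity)]
  have h₄ : (Nat.card {p : G × G // Commute p.1 p.2} : ℚ) ≤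
      H.index * (H.index * Nat.card {p : H × H // Commute p.1 p.2}) := by exact_mod_cast h₃
  calc _ ≤ (H.index * (H.index * Nat.card {p : H × H // Commute p.1 p.2}) : ℚ) *
        (Nat.card H : ℚ) ^ 2 := by gcongr
    _ = _ := by ring

/-- The number of conjugacy classes relative to the order does not increase along an injective
homomorphism of finite groups. -/
theorem card_conjClasses_mul_card_le {N G : Type*} [Group N] [Group G] [Finite G] (f : N →* G)
    (hf : Function.Injective f) :
    Nat.card (ConjClasses G) * Nat.card N ≤ Nat.card (ConjClasses N) * Nat.card G := by
  have e := MonoidHom.ofInjective hf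
  have hN : Finite N := Finite.of_injective f hf
  have h := f.range.commProb_le_commProb
  have hc : Nat.card (ConjClasses N) = Nat.card (ConjClasses f.range) :=
    le_antisymm
      (Nat.card_le_card_of_surjective (ConjClasses.map e.symm.toMonoidHom)
        (ConjClasses.map_surjective e.symm.surjective))
      (Nat.card_le_card_of_surjective (ConjClasses.map e.toMonoidHom)
        (ConjClasses.map_surjective e.surjective))
  rw [commProb_def', commProb_def', ← hc, ← Nat.card_congr e.toEquiv,
    div_le_div_iff₀ (Nat.cast_pos.mpr Finite.card_pos) (Nat.cast_pos.mpr Finite.card_pos)] at h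
  exact_mod_cast h

/-- Every monic polynomial of degree `n` over a field is a characteristic polynomial. -/
theorem Matrix.exists_charpoly_eq {F : Type*} [Field F] {n : ℕ} {p : F[X]} (hp : p.Monic)
    (hn : p.natDegree = n) : ∃ A : Matrix (Fin n) (Fin n) F, A.charpoly = p := by
  subst hn
  let B := AdjoinRoot.powerBasis' hp
  have hB : minpoly F B.gen = p := by
    simpa [B, AdjoinRoot.powerBasis'_gen, hp.leadingCoeff] using AdjoinRoot.minpoly_root hp.ne_zero
  exact ⟨Algebra.leftMulMatrix B.basis B.gen, (charpoly_leftMulMatrix B).trans hB⟩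

theorem card_GL_eq {F : Type*} [Field F] [Fintype F] {n : ℕ} (hn : n ≠ 0) :
    Nat.card (GL (Fin n) F) =
      (Fintype.card F - 1) * Nat.card (Matrix.SpecialLinearGroup (Fin n) F) := by
  have : Nonempty (Fin n) := ⟨0, Nat.pos_of_ne_zero hn⟩
  have h := (Matrix.GeneralLinearGroup.det : GL (Fin n) F →* Fˣ).ker.index_mul_card
  have hs : Nat.card (Matrix.GeneralLinearGroup.det : GL (Fin n) F →* Fˣ).ker =
      Nat.card (Matrix.SpecialLinearGroup (Fin n) F) := by
    refine (Nat.card_congr ((Equiv.ofInjective _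
      Matrix.SpecialLinearGroup.toGL_injective).trans (Equiv.setCongr ?_))).symm
    exact Matrix.SpecialLinearGroup.range_toGL
  rw [Subgroup.index_ker, MonoidHom.range_eq_top.mpr Matrix.GeneralLinearGroup.det_surjective,
    Subgroup.card_top, Nat.card_units, hs, Nat.card_eq_fintype_card] at h
  exact h.symm

theorem index_mul_card_conjClasses_le {F : Type*} [Field F] [Fintype F] {n : ℕ} (hn : n ≠ 0)
    (H : Subgroup (GL (Fin n) F))
    (hH : ∀ g : GL (Fin n) F, Matrix.det (g : Matrix (Fin n) (Fin n) F) = 1 → g ∈ H) :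
    Nat.card (ConjClasses H) * H.index ≤
      (Fintype.card F - 1) * Nat.card (ConjClasses (Matrix.SpecialLinearGroup (Fin n) F)) := by
  have h := card_conjClasses_mul_card_le
    ((Matrix.SpecialLinearGroup.toGL (n := Fin n) (R := F)).codRestrict H fun A => hH _ A.2)
    (fun A B hAB => Matrix.SpecialLinearGroup.toGL_injective (congrArg Subtype.val hAB))
  refine Nat.le_of_mul_le_mul_right (c := Nat.card (Matrix.SpecialLinearGroup (Fin n) F)) ?_
    Finite.card_pos
  calc _ = Nat.card (ConjClasses H) * Nat.card (Matrix.SpecialLinearGroup (Fin n) F) * H.index := by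
        ring
    _ ≤ _ := Nat.mul_le_mul_right _ h
    _ = Nat.card (ConjClasses (Matrix.SpecialLinearGroup (Fin n) F)) *
        (H.index * Nat.card H) := by ring
    _ = _ := by rw [H.index_mul_card, card_GL_eq hn]; ring

theorem le_index_mul_card_conjClasses {F : Type*} [Field F] [Fintype F] {n : ℕ} (hn : n ≠ 0)
    (H : Subgroup (GL (Fin n) F))
    (hH : ∀ g : GL (Fin n) F, Matrix.det (g : Matrix (Fin n) (Fin n) F) = 1 → g ∈ H) :
    Fintype.card F ^ (n - 1) * (Fintype.card F - 1) ≤ Nat.card (ConjClasses H) * H.index := by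
  obtain ⟨m, rfl⟩ : ∃ m, n = m + 1 := Nat.exists_eq_succ_of_ne_zero hn
  set D := H.map Matrix.GeneralLinearGroup.det with hD
  have hker : (Matrix.GeneralLinearGroup.det : GL (Fin (m + 1)) F →* Fˣ).ker ≤ H :=
    fun g hg => hH g (by simpa using congrArg Units.val (MonoidHom.mem_ker.mp hg))
  have hindex : D.index = H.index :=
    Subgroup.index_map_eq H Matrix.GeneralLinearGroup.det_surjective hker
  let P (a : Fin m → F) (d : F) : F[X] := X ^ (m + 1) +
    (∑ i : Fin m, C (a i) * X ^ ((i : ℕ) + 1) + C ((-1) ^ (m + 1) * d))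
  have hdeg : ∀ (a : Fin m → F) (d : F),
        (∑ i : Fin m, C (a i) * X ^ ((i : ℕ) + 1) + C ((-1) ^ (m + 1) * d)).degree <
      ((m + 1 : ℕ) : WithBot ℕ) := by
    intro a d
    refine (degree_add_le _ _).trans_lt (max_lt ?_ ?_)
    · refine (degree_sum_le _ _).trans_lt ((Finset.sup_lt_iff (WithBot.bot_lt_coe _)).mpr ?_)
      intro i _
      refine (degree_C_mul_X_pow_le _ _).trans_lt ?_
      exact_mod_cast Nat.succ_lt_succ i.2
    · exact degree_C_le.trans_lt (by exact_mod_cast Nat.succ_pos m)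
  have hcoeff0 : ∀ a d, (P a d).coeff 0 = (-1) ^ (m + 1) * d := by
    intro a d; simp [P, coeff_X_pow, -map_mul, -map_pow]
  have hcoeff : ∀ a d (i : Fin m), (P a d).coeff (i + 1) = a i := by
    intro a d i
    have : (i : ℕ) ≠ m := i.2.ne
    simp only [P, coeff_add, coeff_X_pow, finsetSum_coeff, coeff_C_mul, coeff_C]
    simp [this, Fin.val_inj]
  have hex : ∀ a (d : Fˣ), ∃ A : GL (Fin (m + 1)) F,
      (A : Matrix (Fin (m + 1)) (Fin (m + 1)) F).charpoly = P a d ∧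
      Matrix.GeneralLinearGroup.det A = d := by
    intro a d
    obtain ⟨A, hA⟩ := Matrix.exists_charpoly_eq (monic_X_pow_add (hdeg a d))
      (natDegree_eq_of_degree_eq_some
        (by rw [degree_add_eq_left_of_degree_lt (by rw [degree_X_pow]; exact hdeg a d),
          degree_X_pow]))
    have hdet : A.det = d := by
      rw [Matrix.det_eq_sign_charpoly_coeff, hA]
      have := hcoeff0 a d
      simp only [P] at this
      rw [this, ← mul_assoc, Fintype.card_fin, ← mul_pow]; simp
    exact ⟨Matrix.GeneralLinearGroup.mkOfDetNeZero A (hdet ▸ d.ne_zero), hA, Units.ext hdet⟩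
  choose A hA hAdet using hex
  have hmem : ∀ a (d : D), A a d ∈ H := by
    rintro a ⟨d, g, hg, rfl⟩
    have : A a (Matrix.GeneralLinearGroup.det g) * g⁻¹ ∈ H := hker (by
      rw [MonoidHom.mem_ker, map_mul, hAdet, map_inv, mul_inv_cancel])
    simpa using H.mul_mem this hg
  have hinj : Function.Injective
      (fun x : (Fin m → F) × D => ConjClasses.mk (⟨A x.1 x.2, hmem x.1 x.2⟩ : H)) := by
    rintro ⟨a, d⟩ ⟨b, e⟩ h
    obtain ⟨c, hc⟩ := isConj_iff.mp (ConjClasses.mk_eq_mk_iff_isConj.mp h)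
    have hc' : (c : GL (Fin (m + 1)) F) * A a d * (c : GL (Fin (m + 1)) F)⁻¹ = A b e :=
      congrArg Subtype.val hc
    have hP : P a d.1 = P b e.1 := by
      rw [← hA, ← hA, ← hc', Units.val_mul, Units.val_mul, Matrix.coe_units_inv,
        Matrix.charpoly_units_conj]
    refine Prod.ext (funext fun i => ?_) (Subtype.ext (Units.ext ?_))
    · show a i = b i
      rw [← hcoeff a d.1 i, hP, hcoeff]
    · have h0 := hcoeff0 a d.1
      rw [hP, hcoeff0] at h0
      exact (mul_left_cancel₀ (pow_ne_zero _ (by simp)) h0).symm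
  have hle := Nat.card_le_card_of_injective _ hinj
  rw [Nat.card_prod, Nat.card_fun, Nat.card_eq_fintype_card, Nat.card_eq_fintype_card (α := Fin m),
    Fintype.card_fin] at hle
  have hDc := D.card_mul_index
  rw [hindex, Nat.card_units, Nat.card_eq_fintype_card (α := F)] at hDc
  rw [← hDc, ← mul_assoc]
  exact Nat.mul_le_mul_right _ hle

/-- The determinant is multiplicative in short exact sequences of finite-dimensional spaces. -/
theorem LinearMap.det_eq_mul_of_exact {K A B C : Type*} [Field K] [AddCommGroup A] [Module K A]
    [AddCommGroup B] [Module K B] [Module.Finite K B] [AddCommGroup C] [Module K C]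
    {i : A →ₗ[K] B} {π : B →ₗ[K] C} (hi : Function.Injective i) (hπ : Function.Surjective π)
    (h : LinearMap.range i = LinearMap.ker π) {a : A →ₗ[K] A} {b : B →ₗ[K] B} {c : C →ₗ[K] C}
    (hab : b ∘ₗ i = i ∘ₗ a) (hbc : π ∘ₗ b = c ∘ₗ π) :
    LinearMap.det b = LinearMap.det a * LinearMap.det c := by
  have hle : LinearMap.ker π ≤ (LinearMap.ker π).comap b := fun x hx => by
    have := LinearMap.congr_fun hbc x
    simp only [LinearMap.comp_apply, LinearMap.mem_ker.mp hx, map_zero] at this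
    simpa using this
  rw [LinearMap.det_eq_det_mul_det (LinearMap.ker π) b hle]
  congr 1
  · let e : A ≃ₗ[K] LinearMap.ker π := (LinearEquiv.ofInjective i hi).trans (LinearEquiv.ofEq _ _ h)
    rw [← LinearMap.det_conj a e]
    congr 1
    ext x
    obtain ⟨y, rfl⟩ := e.surjective x
    simp only [LinearMap.comp_apply, LinearEquiv.coe_coe, e.symm_apply_apply]
    exact LinearMap.congr_fun hab y
  · let e := π.quotKerEquivOfSurjective hπ
    rw [← LinearMap.det_conj _ e]
    congr 1
    ext x
    obtain ⟨y, rfl⟩ := hπ x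
    have : e.symm (π y) = (LinearMap.ker π).mkQ y := by
      rw [LinearEquiv.symm_apply_eq]; rfl
    simp only [LinearMap.comp_apply, LinearEquiv.coe_coe, this]
    exact LinearMap.congr_fun hbc y

theorem LinearMap.det_piMap {K ι : Type*} [Field K] [Fintype ι] {M : ι → Type*}
    [∀ i, AddCommGroup (M i)] [∀ i, Module K (M i)] [∀ i, Module.Finite K (M i)]
    (f : ∀ i, M i →ₗ[K] M i) :
    LinearMap.det (LinearMap.piMap f) = ∏ i, LinearMap.det (f i) := by
  classical
  have hsingle : ∀ i (g : M i →ₗ[K] M i),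
      LinearMap.det (LinearMap.piMap (Function.update (fun j => LinearMap.id (M := M j)) i g)) =
        LinearMap.det g := by
    intro i g
    have h₁ : LinearMap.piMap (Function.update (fun j => LinearMap.id (M := M j)) i g) ∘ₗ
        LinearMap.single K M i = LinearMap.single K M i ∘ₗ g := by
      refine LinearMap.ext fun x => funext fun j => ?_
      by_cases hj : j = i
      · subst hj; simp
      · simp [hj]
    have h₂ : (LinearMap.range (LinearMap.single K M i)).mkQ ∘ₗ
        LinearMap.piMap (Function.update (fun j => LinearMap.id (M := M j)) i g) =
        LinearMap.id ∘ₗ (LinearMap.range (LinearMap.single K M i)).mkQ := by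
      refine LinearMap.ext fun x => ?_
      simp only [LinearMap.comp_apply, LinearMap.id_apply, Submodule.mkQ_apply]
      rw [Submodule.Quotient.eq]
      refine ⟨g (x i) - x i, funext fun j => ?_⟩
      by_cases hj : j = i
      · subst hj; simp
      · simp [hj]
    rw [LinearMap.det_eq_mul_of_exact (Pi.single_injective i) (Submodule.mkQ_surjective _)
      (Submodule.ker_mkQ _).symm h₁ h₂, LinearMap.det_id, mul_one]
  have hs : ∀ s : Finset ι,
      LinearMap.det (LinearMap.piMap (fun j => if j ∈ s then f j else LinearMap.id)) =
        ∏ i ∈ s, LinearMap.det (f i) := by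
    intro s
    induction s using Finset.induction_on with
    | empty =>
      have : LinearMap.piMap (fun j => LinearMap.id (R := K) (M := M j)) = LinearMap.id :=
        LinearMap.ext fun x => rfl
      simp [this]
    | insert i s hi ih =>
      rw [Finset.prod_insert hi, ← ih, ← hsingle i (f i), ← LinearMap.det_comp]
      congr 1
      refine LinearMap.ext fun x => funext fun j => ?_
      by_cases hj : j = i
      · subst hj; simp [hi]
      · simp [hj]
  simpa using hs Finset.univ

theorem Polynomial.det_lsmul_quotient_span_pow {F : Type*} [Field F] {p : F[X]} (hp : p.Monic)
    (f : F[X])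
    (e : ℕ) :
    LinearMap.det (Algebra.lsmul F F (F[X] ⧸ Ideal.span {p ^ e}) f) =
      LinearMap.det (Algebra.lsmul F F (F[X] ⧸ Ideal.span {p}) f) ^ e := by
  induction e with
  | zero =>
    have : Subsingleton (F[X] ⧸ Ideal.span {p ^ 0}) :=
      Ideal.Quotient.subsingleton_iff.mpr (by simp)
    rw [LinearMap.det_eq_one_of_subsingleton, pow_zero]
  | succ e ih =>
    have := (hp.pow (e + 1)).finite_quotient
    let i : (F[X] ⧸ Ideal.span {p}) →ₗ[F[X]] F[X] ⧸ Ideal.span {p ^ (e + 1)} :=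
      Submodule.mapQ _ _ (LinearMap.lsmul F[X] F[X] (p ^ e)) (by
        intro x hx
        obtain ⟨y, rfl⟩ := Ideal.mem_span_singleton.mp hx
        exact Ideal.mem_span_singleton.mpr ⟨y, by simp [pow_succ, mul_assoc]⟩)
    let π : (F[X] ⧸ Ideal.span {p ^ (e + 1)}) →ₗ[F[X]] F[X] ⧸ Ideal.span {p ^ e} :=
      Submodule.factor (Ideal.span_singleton_le_span_singleton.mpr (pow_dvd_pow p e.le_succ))
    have hi : Function.Injective i := by
      refine (injective_iff_map_eq_zero i).mpr fun x hx => ?_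
      obtain ⟨x, rfl⟩ := Submodule.Quotient.mk_surjective _ x
      have : p ^ e * x ∈ Ideal.span {p ^ (e + 1)} := (Submodule.Quotient.mk_eq_zero _).mp hx
      rw [Ideal.mem_span_singleton, pow_succ] at this
      exact (Submodule.Quotient.mk_eq_zero _).mpr (Ideal.mem_span_singleton.mpr
        ((mul_dvd_mul_iff_left (pow_ne_zero e hp.ne_zero)).mp this))
    have hπ : Function.Surjective π := Submodule.factor_surjective _
    have hex : LinearMap.range i = LinearMap.ker π := by
      refine le_antisymm ?_ fun x hx => ?_
      · rintro _ ⟨x, rfl⟩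
        obtain ⟨x, rfl⟩ := Submodule.Quotient.mk_surjective _ x
        exact (Submodule.Quotient.mk_eq_zero _).mpr
          (Ideal.mem_span_singleton.mpr (Dvd.intro _ rfl))
      · obtain ⟨x, rfl⟩ := Submodule.Quotient.mk_surjective _ x
        obtain ⟨y, rfl⟩ := Ideal.mem_span_singleton.mp
          ((Submodule.Quotient.mk_eq_zero (Ideal.span {p ^ e})).mp hx)
        exact ⟨Submodule.Quotient.mk y, rfl⟩
    rw [LinearMap.det_eq_mul_of_exact (i := i.restrictScalars F) (π := π.restrictScalars F) hi hπ
      (SetLike.ext fun x => SetLike.ext_iff.mp hex x)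
      (a := Algebra.lsmul F F _ f) (c := Algebra.lsmul F F _ f)
      (LinearMap.ext fun x => (i.map_smul f x).symm) (LinearMap.ext fun x => π.map_smul f x), ih,
      pow_succ']

theorem Polynomial.det_lsmul_quotient_span {F : Type*} [Field F] (p f : F[X]) :
    LinearMap.det (Algebra.lsmul F F (F[X] ⧸ Ideal.span {p}) f) =
      Algebra.norm F (AdjoinRoot.mk p f) := by
  rw [Algebra.norm_apply]
  congr 1

theorem Polynomial.det_lsmul_X_quotient_span {F : Type*} [Field F] {p : F[X]} (hp : p.Monic) :
    LinearMap.det (Algebra.lsmul F F (F[X] ⧸ Ideal.span {p}) (X : F[X])) =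
      (-1) ^ p.natDegree * p.coeff 0 := by
  let B := AdjoinRoot.powerBasis' hp
  have hB : minpoly F B.gen = p := by
    simpa [B, AdjoinRoot.powerBasis'_gen, hp.leadingCoeff] using AdjoinRoot.minpoly_root hp.ne_zero
  have h := Algebra.PowerBasis.norm_gen_eq_coeff_zero_minpoly B
  rw [hB] at h
  rw [Polynomial.det_lsmul_quotient_span]
  exact h

theorem Polynomial.exists_det_lsmul_quotient_span_eq {F : Type*} [Field F] [Finite F] {p : F[X]}
    (hp : Irreducible p) (a : Fˣ) :
    ∃ f : F[X], LinearMap.det (Algebra.lsmul F F (F[X] ⧸ Ideal.span {p}) f) = a := by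
  have := Fact.mk hp
  have : Module.Finite F (AdjoinRoot p) := (AdjoinRoot.powerBasis (f := p) hp.ne_zero).finite
  have : Finite (AdjoinRoot p) := Module.finite_of_finite F
  obtain ⟨x, hx⟩ := FiniteField.norm_surjective F (AdjoinRoot p) (a : F)
  obtain ⟨f, rfl⟩ := AdjoinRoot.mk_surjective (g := p) x
  exact ⟨f, by rw [Polynomial.det_lsmul_quotient_span, hx]⟩
theorem Polynomial.card_fiber_eq_count {F ι E : Type*} [Field F] [Fintype ι] [DecidableEq F]
    [DecidableEq F[X]] [DecidableEq E] {p : ι → F[X]} {e : ι → E} (hp : ∀ i, Irreducible (p i))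
    (hm : ∀ i, (p i).Monic) (x : F[X] × E) :
    Fintype.card {i // (p i, e i) = x} =
      (UniqueFactorizationMonoid.normalizedFactors (∏ i with e i = x.2, p i)).count x.1 := by
  have := UniqueFactorizationMonoid.normalizedFactors_prod_eq
    ((Finset.univ.filter fun i => e i = x.2).val.map p) (by simp [hp])
  rw [Finset.prod_eq_multiset_prod, this, Multiset.map_map,
    Multiset.map_congr (f := normalize ∘ p) (g := p) rfl (fun i _ => (hm i).normalize_eq_self),
    Multiset.count_map,
    Fintype.card_subtype, ← Finset.filter_val, Finset.card_val, Finset.filter_filter]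
  congr 1
  ext i
  simp [Prod.ext_iff, and_comm, eq_comm]

/-- Two finite families of monic irreducible polynomials labelled by `e` and `e'` agree up to
reindexing once the products over each label agree. -/
theorem Polynomial.exists_equiv_of_prod_eq {F ι κ E : Type*} [Field F] [Fintype ι] [Fintype κ]
    [DecidableEq E] {p : ι → F[X]} {p' : κ → F[X]} {e : ι → E} {e' : κ → E}
    (hp : ∀ i, Irreducible (p i)) (hm : ∀ i, (p i).Monic)
    (hp' : ∀ i, Irreducible (p' i)) (hm' : ∀ i, (p' i).Monic)
    (h : ∀ k, ∏ i with e i = k, p i = ∏ i with e' i = k, p' i) :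
    ∃ σ : ι ≃ κ, ∀ i, p' (σ i) = p i ∧ e' (σ i) = e i := by
  classical
  have hc : ∀ x : F[X] × E,
      Nonempty ({i // (p i, e i) = x} ≃ {i // (p' i, e' i) = x}) := fun x =>
    Fintype.card_eq.mp (by rw [card_fiber_eq_count hp hm, card_fiber_eq_count hp' hm', h])
  let σ := Equiv.ofFiberEquiv fun x => (hc x).some
  have hσ : ∀ i, (p' (σ i), e' (σ i)) = (p i, e i) := fun i =>
    Equiv.ofFiberEquiv_map (fun x => (hc x).some) i
  exact ⟨σ, fun i => Prod.ext_iff.mp (hσ i)⟩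

/-- An isomorphism of the `F[X]`-modules of two matrices intertwines the matrices. -/
theorem Matrix.exists_GL_of_linearEquiv {F : Type*} [Field F] {n : ℕ}
    {A B : Matrix (Fin n) (Fin n) F}
    (φ : Module.AEval' A.toLin' ≃ₗ[F[X]] Module.AEval' B.toLin') :
    ∃ P : GL (Fin n) F, (P : Matrix (Fin n) (Fin n) F) * A = B * P ∧
      ((Matrix.GeneralLinearGroup.det P : Fˣ) : F) =
        LinearMap.det ((Module.AEval'.of B.toLin').symm.toLinearMap ∘ₗ
          φ.toLinearMap.restrictScalars F ∘ₗ (Module.AEval'.of A.toLin').toLinearMap) := by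
  let E : (Fin n → F) ≃ₗ[F] (Fin n → F) := (Module.AEval'.of A.toLin').trans
    ((φ.restrictScalars F).trans (Module.AEval'.of B.toLin').symm)
  have hE : E.toLinearMap ∘ₗ A.toLin' = B.toLin' ∘ₗ E.toLinearMap := by
    refine LinearMap.ext fun v => ?_
    have := φ.map_smul X (Module.AEval'.of A.toLin' v)
    rw [Module.AEval'.X_smul_of] at this
    have h2 := congrArg (Module.AEval'.of B.toLin').symm this
    rwa [Module.AEval'.of_symm_X_smul] at h2
  have hdet : (LinearMap.toMatrix' E.toLinearMap).det = LinearMap.det E.toLinearMap :=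
    LinearMap.det_toMatrix' _
  refine ⟨Matrix.GeneralLinearGroup.mkOfDetNeZero (LinearMap.toMatrix' E.toLinearMap)
    (hdet ▸ E.isUnit_det'.ne_zero), ?_, hdet⟩
  have := congrArg LinearMap.toMatrix' hE
  rwa [LinearMap.toMatrix'_comp, LinearMap.toMatrix'_comp, LinearMap.toMatrix'_toLin',
    LinearMap.toMatrix'_toLin'] at this

/-- `A` has primary type `g` if the blocks of its primary decomposition with exponent `k + 1`
belong to monic irreducible polynomials with product `g k`. -/
def Matrix.HasPrimaryType {F : Type*} [Field F] {n : ℕ} (A : Matrix (Fin n) (Fin n) F)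
    (g : Fin n → F[X]) : Prop :=
  ∃ (m : ℕ) (p : Fin m → F[X]) (e : Fin m → Fin n), (∀ i, Irreducible (p i)) ∧
    (∀ i, (p i).Monic) ∧ (∀ k, g k = ∏ i with e i = k, p i) ∧
    Nonempty (Module.AEval' A.toLin' ≃ₗ[F[X]]
      ((i : Fin m) → F[X] ⧸ Ideal.span {p i ^ ((e i : ℕ) + 1)}))

theorem Matrix.HasPrimaryType.monic {F : Type*} [Field F] {n : ℕ} {A : Matrix (Fin n) (Fin n) F}
    {g : Fin n → F[X]} (h : A.HasPrimaryType g) (k : Fin n) : (g k).Monic := by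
  obtain ⟨m, p, e, -, hm, hg, -⟩ := h
  rw [hg]
  exact monic_prod_of_monic _ _ fun i _ => hm i

/-- Matrices of the same primary type are similar. -/
theorem Matrix.HasPrimaryType.exists_GL {F : Type*} [Field F] {n : ℕ}
    {A B : Matrix (Fin n) (Fin n) F} {g : Fin n → F[X]} (hA : A.HasPrimaryType g)
    (hB : B.HasPrimaryType g) : ∃ P : GL (Fin n) F, (P : Matrix (Fin n) (Fin n) F) * A = B * P := by
  obtain ⟨m, p, e, hp, hm, hg, ⟨φ⟩⟩ := hA
  obtain ⟨m', p', e', hp', hm', hg', ⟨φ'⟩⟩ := hB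
  obtain ⟨σ, hσ⟩ := Polynomial.exists_equiv_of_prod_eq hp hm hp' hm' fun k =>
    (hg k).symm.trans (hg' k)
  let ψ : ((i : Fin m) → F[X] ⧸ Ideal.span {p i ^ ((e i : ℕ) + 1)}) ≃ₗ[F[X]]
      ((i : Fin m') → F[X] ⧸ Ideal.span {p' i ^ ((e' i : ℕ) + 1)}) :=
    (LinearEquiv.piCongrRight fun i => Submodule.quotEquivOfEq _ _
      (by rw [(hσ i).1, (hσ i).2])).trans
      (LinearEquiv.piCongrLeft F[X] (fun i => F[X] ⧸ Ideal.span {p' i ^ ((e' i : ℕ) + 1)}) σ)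
  obtain ⟨P, hP, -⟩ := Matrix.exists_GL_of_linearEquiv ((φ.trans ψ).trans φ'.symm)
  exact ⟨P, hP⟩

theorem Polynomial.finrank_pi_quotient_span {F ι : Type*} [Field F] [Fintype ι] {p : ι → F[X]}
    (hm : ∀ i, (p i).Monic) :
    Module.finrank F ((i : ι) → F[X] ⧸ Ideal.span {p i}) = ∑ i, (p i).natDegree := by
  have := fun i => (hm i).finite_quotient
  have := fun i => (hm i).free_quotient
  rw [Module.finrank_pi_fintype]
  exact Finset.sum_congr rfl fun i _ => finrank_quotient_span_eq_natDegree

theorem Matrix.finrank_AEval {F : Type*} [Field F] {n : ℕ} (A : Matrix (Fin n) (Fin n) F) :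
    Module.finrank F (Module.AEval' A.toLin') = n := by
  rw [← (Module.AEval'.of A.toLin').finrank_eq, Module.finrank_fin_fun]

theorem Polynomial.sum_mul_natDegree_prod_fiber {F ι : Type*} [Field F] [Fintype ι] {n : ℕ}
    {p : ι → F[X]} (hp : ∀ i, (p i).Monic) (e : ι → Fin n) :
    ∑ k : Fin n, ((k : ℕ) + 1) * (∏ i with e i = k, p i).natDegree =
      ∑ i, ((e i : ℕ) + 1) * (p i).natDegree := by
  rw [← Finset.sum_fiberwise _ e]
  refine Finset.sum_congr rfl fun k _ => ?_
  rw [natDegree_prod_of_monic _ _ fun i _ => hp i, Finset.mul_sum]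
  exact Finset.sum_congr rfl fun i hi => by rw [(Finset.mem_filter.mp hi).2]

theorem Matrix.HasPrimaryType.sum_natDegree {F : Type*} [Field F] {n : ℕ}
    {A : Matrix (Fin n) (Fin n) F} {g : Fin n → F[X]} (h : A.HasPrimaryType g) :
    ∑ k : Fin n, ((k : ℕ) + 1) * (g k).natDegree = n := by
  obtain ⟨m, p, e, -, hm, hg, ⟨φ⟩⟩ := h
  have h := (φ.restrictScalars F).finrank_eq
  rw [Matrix.finrank_AEval, Polynomial.finrank_pi_quotient_span fun i => (hm i).pow _] at h
  rw [Finset.sum_congr rfl fun k _ => by rw [hg], Polynomial.sum_mul_natDegree_prod_fiber hm,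
    ← Finset.sum_congr rfl fun i _ => (hm i).natDegree_pow _, ← h]

theorem Matrix.HasPrimaryType.prod_coeff_zero {F : Type*} [Field F] {n : ℕ}
    {A : Matrix (Fin n) (Fin n) F} {g : Fin n → F[X]} (h : A.HasPrimaryType g) :
    ∏ k : Fin n, (g k).coeff 0 ^ ((k : ℕ) + 1) = (-1) ^ n * A.det := by
  have hn := h.sum_natDegree
  obtain ⟨m, p, e, -, hm, hg, ⟨φ⟩⟩ := h
  have := fun i => ((hm i).pow ((e i : ℕ) + 1)).finite_quotient
  have hA : A.det = ∏ i, ((-1) ^ (p i).natDegree * (p i).coeff 0) ^ ((e i : ℕ) + 1) := by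
    calc A.det = LinearMap.det A.toLin' := (LinearMap.det_toLin' A).symm
      _ = LinearMap.det (((Module.AEval'.of A.toLin').trans (φ.restrictScalars F)).toLinearMap ∘ₗ
          A.toLin' ∘ₗ ((Module.AEval'.of A.toLin').trans (φ.restrictScalars F)).symm.toLinearMap) :=
        (LinearMap.det_conj _ _).symm
      _ = LinearMap.det (LinearMap.piMap fun i => Algebra.lsmul F F
          (F[X] ⧸ Ideal.span {p i ^ ((e i : ℕ) + 1)}) (X : F[X])) := by
        congr 1
        refine LinearMap.ext fun v => ?_
        obtain ⟨v, rfl⟩ := ((Module.AEval'.of A.toLin').trans (φ.restrictScalars F)).surjective v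
        simp only [LinearMap.comp_apply, LinearEquiv.coe_coe, LinearEquiv.symm_apply_apply]
        exact (congrArg φ (Module.AEval'.X_smul_of A.toLin' v).symm).trans (φ.map_smul X _)
      _ = _ := by
        rw [LinearMap.det_piMap]
        refine Finset.prod_congr rfl fun i _ => ?_
        rw [Polynomial.det_lsmul_quotient_span_pow (hm i),
          Polynomial.det_lsmul_X_quotient_span (hm i)]
  have hsplit : ∀ f : F[X] →* F, ∏ k, f (g k) ^ ((k : ℕ) + 1) = ∏ i, f (p i) ^ ((e i : ℕ) + 1) := by
    intro f
    rw [← Finset.prod_fiberwise _ e]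
    refine Finset.prod_congr rfl fun k _ => ?_
    rw [hg, map_prod, ← Finset.prod_pow]
    exact Finset.prod_congr rfl fun i hi => by rw [(Finset.mem_filter.mp hi).2]
  have h0 := hsplit (constantCoeff : F[X] →+* F)
  simp only [MonoidHom.coe_coe, constantCoeff_apply] at h0
  have hsum : ∑ i, ((e i : ℕ) + 1) * (p i).natDegree = n := by
    refine Eq.trans ?_ hn
    rw [← Polynomial.sum_mul_natDegree_prod_fiber hm]
    exact Finset.sum_congr rfl fun k _ => by rw [hg]
  have hsign : ∏ i, ((-1 : F) ^ (p i).natDegree) ^ ((e i : ℕ) + 1) = (-1) ^ n := by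
    refine Eq.trans ?_ (congrArg ((-1 : F) ^ ·) hsum)
    simp only [← Finset.prod_pow_eq_pow_sum]
    exact Finset.prod_congr rfl fun i _ => by rw [← pow_mul, mul_comm]
  rw [h0, hA, Finset.prod_congr rfl fun i _ => mul_pow _ _ _, Finset.prod_mul_distrib, hsign,
    ← mul_assoc, ← mul_pow]
  simp

/-- The determinants of the matrices commuting with `A` contain all `(k + 1)`-st powers if some
block of exponent `k + 1` occurs. -/
theorem Matrix.HasPrimaryType.exists_commute_det_eq {F : Type*} [Field F] [Finite F] {n : ℕ}
    {A : Matrix (Fin n) (Fin n) F} {g : Fin n → F[X]} (h : A.HasPrimaryType g) {k : Fin n}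
    (hk : (g k).natDegree ≠ 0) (a : Fˣ) :
    ∃ P : GL (Fin n) F, (P : Matrix (Fin n) (Fin n) F) * A = A * P ∧
      Matrix.GeneralLinearGroup.det P = a ^ ((k : ℕ) + 1) := by
  classical
  obtain ⟨m, p, e, hp, hm, hg, ⟨φ⟩⟩ := h
  have := fun i => ((hm i).pow ((e i : ℕ) + 1)).finite_quotient
  obtain ⟨i, hi⟩ : ∃ i, e i = k := by
    by_contra! H
    refine hk ?_
    rw [hg, Finset.filter_false_of_mem fun i _ => H i]
    simp
  obtain ⟨f, hf⟩ := Polynomial.exists_det_lsmul_quotient_span_eq (hp i) a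
  let M : Fin m → Type _ := fun i => F[X] ⧸ Ideal.span {p i ^ ((e i : ℕ) + 1)}
  let T : ((i : Fin m) → M i) →ₗ[F[X]] ((i : Fin m) → M i) :=
    LinearMap.piMap fun j => LinearMap.lsmul F[X] (M j) (if j = i then f else 1)
  have hT : LinearMap.det (T.restrictScalars F) = (a : F) ^ ((k : ℕ) + 1) := by
    have : T.restrictScalars F = LinearMap.piMap fun j =>
      (Algebra.lsmul F F (M j) (if j = i then f else 1) : M j →ₗ[F] M j) := rfl
    rw [this, LinearMap.det_piMap, Finset.prod_eq_single i]
    · simp only [if_true, M]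
      rw [Polynomial.det_lsmul_quotient_span_pow (hm i), hf, hi]
    · intro j _ hj
      simp [hj]
    · simp
  have hTu : IsUnit (LinearMap.det (T.restrictScalars F)) := by
    rw [hT]; exact (a.isUnit.pow _)
  have hTb : Function.Bijective T :=
    (Module.End.isUnit_iff (T.restrictScalars F)).mp ((LinearMap.isUnit_iff_isUnit_det _).mpr hTu)
  obtain ⟨P, hP, hd⟩ := Matrix.exists_GL_of_linearEquiv
    ((φ.trans (LinearEquiv.ofBijective T hTb)).trans φ.symm)
  refine ⟨P, hP, Units.ext (hd.trans ?_)⟩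
  rw [Units.val_pow_eq_pow_val, ← hT, ← LinearMap.det_conj _
    ((Module.AEval'.of A.toLin').trans (φ.restrictScalars F)).symm]
  rfl

theorem Matrix.exists_hasPrimaryType {F : Type*} [Field F] {n : ℕ} (A : Matrix (Fin n) (Fin n) F) :
    ∃ g, A.HasPrimaryType g := by
  classical
  obtain ⟨ι, _, p, hp, e, ⟨φ⟩⟩ := Module.equiv_directSum_of_isTorsion
    (Module.AEval.isTorsion_of_finiteDimensional F (Fin n → F) A.toLin')
  let Q : ι → Type _ := fun i => F[X] ⧸ Ideal.span {p i ^ e i}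
  let κ := {i // e i ≠ 0}
  let r : ((i : ι) → Q i) →ₗ[F[X]] ((i : κ) → Q i) := LinearMap.pi fun i => LinearMap.proj i.1
  have hr : Function.Bijective r := by
    constructor
    · refine (injective_iff_map_eq_zero r).mpr fun x hx => funext fun i => ?_
      by_cases hi : e i = 0
      · have : Subsingleton (Q i) := Ideal.Quotient.subsingleton_iff.mpr (by simp [hi])
        exact Subsingleton.elim _ _
      · exact congrFun hx ⟨i, hi⟩
    · intro y
      refine ⟨fun i => if hi : e i ≠ 0 then y ⟨i, hi⟩ else 0, funext fun i => ?_⟩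
      exact dif_pos i.2
  let σ := Fintype.equivFin κ
  let p' : Fin (Fintype.card κ) → F[X] := fun i => normalize (p (σ.symm i))
  let e' : Fin (Fintype.card κ) → ℕ := fun i => e (σ.symm i)
  have hp' : ∀ i, Irreducible (p' i) := fun i =>
    (normalize_associated _).symm.irreducible (hp _)
  have hm' : ∀ i, (p' i).Monic := fun i => monic_normalize (hp _).ne_zero
  let ψ : ((i : κ) → Q i) ≃ₗ[F[X]]
      ((i : Fin (Fintype.card κ)) → F[X] ⧸ Ideal.span {p' i ^ e' i}) :=
    (LinearEquiv.piCongrRight fun i => Submodule.quotEquivOfEq _ _ (by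
        rw [Ideal.span_singleton_eq_span_singleton]
        simpa [p', e'] using (normalize_associated (p i)).symm.pow_pow)).trans
      (LinearEquiv.piCongrLeft F[X] (fun i => F[X] ⧸ Ideal.span {p' i ^ e' i}) σ)
  let Φ : Module.AEval' A.toLin' ≃ₗ[F[X]]
      ((i : Fin (Fintype.card κ)) → F[X] ⧸ Ideal.span {p' i ^ e' i}) :=
    ((φ.trans (DirectSum.linearEquivFunOnFintype F[X] ι Q)).trans
      (LinearEquiv.ofBijective r hr)).trans ψ
  have hle : ∀ i, e' i ≤ n := by
    intro i
    have h := (Φ.restrictScalars F).finrank_eq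
    rw [Matrix.finrank_AEval, Polynomial.finrank_pi_quotient_span fun i => (hm' i).pow _] at h
    calc e' i ≤ e' i * (p' i).natDegree := Nat.le_mul_of_pos_right _ (hp' i).natDegree_pos
      _ = (p' i ^ e' i).natDegree := ((hm' i).natDegree_pow _).symm
      _ ≤ ∑ i, (p' i ^ e' i).natDegree :=
        Finset.single_le_sum (f := fun i => (p' i ^ e' i).natDegree) (fun _ _ => Nat.zero_le _)
          (Finset.mem_univ i)
      _ = n := h.symm
  have hpos : ∀ i, e' i - 1 + 1 = e' i := fun i =>
    Nat.sub_add_cancel (Nat.pos_of_ne_zero (σ.symm i).2)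
  refine ⟨_, _, p', fun i => ⟨e' i - 1, (hpos i).le.trans (hle i)⟩, hp', hm', fun k => rfl, ⟨?_⟩⟩
  exact Φ.trans (LinearEquiv.piCongrRight fun i => Submodule.quotEquivOfEq _ _ (by
    simp only [hpos]))

/-- The product of the subgroups of `(k + 1)`-st powers over all `k` with `m k ≠ 0`. -/
def powSubgroup (G : Type*) [CommGroup G] {n : ℕ} (m : Fin n → ℕ) : Subgroup G :=
  ⨆ (k : Fin n) (_ : m k ≠ 0), (powMonoidHom ((k : ℕ) + 1) : G →* G).range

theorem powSubgroup_index_dvd {G : Type*} [CommGroup G] [IsCyclic G] [Finite G] {n : ℕ}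
    {m : Fin n → ℕ} {k : Fin n} (hk : m k ≠ 0) : (powSubgroup G m).index ∣ (k : ℕ) + 1 := by
  have hle : (powMonoidHom ((k : ℕ) + 1) : G →* G).range ≤ powSubgroup G m :=
    le_iSup₂_of_le k hk le_rfl
  refine (Subgroup.index_dvd_of_le hle).trans ?_
  rw [IsCyclic.index_powMonoidHom_range]
  exact Nat.gcd_dvd_right _ _

/-- The number of monic polynomials of degree `m` with nonzero constant coefficient over a field
with `q` elements. -/
def numMonic (q m : ℕ) : ℕ := if m = 0 then 1 else q ^ (m - 1) * (q - 1)

theorem finite_and_card_monic_le (F : Type*) [Field F] [Fintype F] (m : ℕ) :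
    Finite {p : F[X] // p.Monic ∧ p.natDegree = m ∧ p.coeff 0 ≠ 0} ∧
    Nat.card {p : F[X] // p.Monic ∧ p.natDegree = m ∧ p.coeff 0 ≠ 0} ≤
      numMonic (Fintype.card F) m := by
  cases m with
  | zero =>
    have : Subsingleton {p : F[X] // p.Monic ∧ p.natDegree = 0 ∧ p.coeff 0 ≠ 0} :=
      ⟨fun p p' => Subtype.ext (by
        rw [p.2.1.natDegree_eq_zero.mp p.2.2.1, p'.2.1.natDegree_eq_zero.mp p'.2.2.1])⟩
    exact ⟨inferInstance, by simpa [numMonic] using Finite.card_le_one_iff_subsingleton.mpr this⟩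
  | succ m =>
    let f : {p : F[X] // p.Monic ∧ p.natDegree = m + 1 ∧ p.coeff 0 ≠ 0} → (Fin m → F) × Fˣ :=
      fun p => (fun i => p.1.coeff (i + 1), Units.mk0 (p.1.coeff 0) p.2.2.2)
    have hf : Function.Injective f := by
      intro p p' h
      obtain ⟨h₁, h₂⟩ := Prod.ext_iff.mp h
      refine Subtype.ext (Polynomial.ext fun i => ?_)
      rcases Nat.lt_trichotomy i (m + 1) with hi | hi | hi
      · cases i with
        | zero => exact congrArg Units.val h₂
        | succ i => exact congrFun h₁ ⟨i, Nat.lt_of_succ_lt_succ hi⟩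
      · have h := p.2.1.coeff_natDegree
        have h' := p'.2.1.coeff_natDegree
        rw [p.2.2.1] at h
        rw [p'.2.2.1] at h'
        rw [hi, h, h']
      · rw [coeff_eq_zero_of_natDegree_lt (p.2.2.1.trans_lt hi),
          coeff_eq_zero_of_natDegree_lt (p'.2.2.1.trans_lt hi)]
    refine ⟨Finite.of_injective f hf, (Nat.card_le_card_of_injective f hf).trans ?_⟩
    rw [Nat.card_prod, Nat.card_fun, Nat.card_units, Nat.card_eq_fintype_card,
      Nat.card_eq_fintype_card (α := Fin m), Fintype.card_fin]
    simp [numMonic]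

/-- Scaling the constant coefficient of a polynomial. -/
noncomputable def Polynomial.scaleConst {F : Type*} [Field F] (u : F) (p : F[X]) : F[X] :=
  p + C ((u - 1) * p.coeff 0)

theorem Polynomial.coeff_zero_scaleConst {F : Type*} [Field F] (u : F) (p : F[X]) :
    (p.scaleConst u).coeff 0 = u * p.coeff 0 := by
  simp [scaleConst]; ring

theorem Polynomial.scaleConst_injective {F : Type*} [Field F] {u : F} (hu : u ≠ 0) :
    Function.Injective (scaleConst u) := by
  intro p p' h
  have h0 : p.coeff 0 = p'.coeff 0 := mul_left_cancel₀ hu (by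
    rw [← coeff_zero_scaleConst, h, coeff_zero_scaleConst])
  unfold scaleConst at h
  rw [h0] at h
  exact add_right_cancel h

theorem Polynomial.natDegree_scaleConst {F : Type*} [Field F] (u : F) (p : F[X]) :
    (p.scaleConst u).natDegree = p.natDegree := natDegree_add_C

theorem Polynomial.Monic.scaleConst {F : Type*} [Field F] {u : F} {p : F[X]} (hp : p.Monic)
    (hu : p.natDegree = 0 → u = 1) : (p.scaleConst u).Monic := by
  by_cases h : p.natDegree = 0
  · simpa [Polynomial.scaleConst, hu h] using hp
  · exact hp.add_of_left (degree_C_le.trans_lt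
      (natDegree_pos_iff_degree_pos.mp (Nat.pos_of_ne_zero h)))

theorem exists_prod_pow_eq_of_mem_powSubgroup {G : Type*} [CommGroup G] {n : ℕ} {m : Fin n → ℕ}
    {d : G} (hd : d ∈ powSubgroup G m) :
    ∃ u : Fin n → G, (∀ k, m k = 0 → u k = 1) ∧ ∏ k, u k ^ ((k : ℕ) + 1) = d := by
  classical
  let S : Subgroup G :=
    { carrier := {d | ∃ u : Fin n → G, (∀ k, m k = 0 → u k = 1) ∧ ∏ k, u k ^ ((k : ℕ) + 1) = d}
      one_mem' := ⟨1, by simp⟩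
      mul_mem' := by
        rintro _ _ ⟨u, hu, rfl⟩ ⟨v, hv, rfl⟩
        exact ⟨u * v, fun k hk => by simp [hu k hk, hv k hk], by
          simp [mul_pow, Finset.prod_mul_distrib]⟩
      inv_mem' := by
        rintro _ ⟨u, hu, rfl⟩
        exact ⟨u⁻¹, fun k hk => by simp [hu k hk], by simp⟩ }
  refine (iSup₂_le fun k hk => ?_ : powSubgroup G m ≤ S) hd
  rintro _ ⟨a, rfl⟩
  refine ⟨Pi.mulSingle k a, fun j hj => ?_, ?_⟩
  · exact Pi.mulSingle_eq_of_ne (by rintro rfl; exact hk hj) _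
  · rw [Finset.prod_eq_single k]
    · simp
    · intro j _ hj
      simp [Pi.mulSingle_eq_of_ne hj]
    · simp

/-- Families of monic polynomials of degrees `m k` whose constant coefficients satisfy one
multiplicative relation. -/
theorem card_mul_card_powSubgroup_le {F : Type*} [Field F] [Fintype F] {n : ℕ} {m : Fin n → ℕ}
    {c : F} (hc : c ≠ 0) (S : Finset (Fin n → F[X])) (hS : ∀ g ∈ S, (∀ k, (g k).Monic) ∧
      (∀ k, (g k).natDegree = m k) ∧ ∏ k, (g k).coeff 0 ^ ((k : ℕ) + 1) = c) :
    S.card * Nat.card (powSubgroup Fˣ m) ≤ ∏ k, numMonic (Fintype.card F) (m k) := by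
  have := fun k => (finite_and_card_monic_le F (m k)).1
  refine le_trans ?_ (Finset.prod_le_prod' fun k _ => (finite_and_card_monic_le F (m k)).2)
  rw [← Nat.card_pi, ← Nat.card_eq_finsetCard, ← Nat.card_prod]
  choose u hu hud using fun d : powSubgroup Fˣ m => exists_prod_pow_eq_of_mem_powSubgroup d.2
  have hne : ∀ g ∈ S, ∀ k, (g k).coeff 0 ≠ 0 := by
    intro g hg k h
    refine hc ((hS g hg).2.2 ▸ Finset.prod_eq_zero (Finset.mem_univ k) ?_)
    rw [h, zero_pow (Nat.succ_ne_zero _)]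
  let f : S × powSubgroup Fˣ m →
      ∀ k, {p : F[X] // p.Monic ∧ p.natDegree = m k ∧ p.coeff 0 ≠ 0} := fun x k =>
    ⟨(x.1.1 k).scaleConst (u x.2 k), ((hS _ x.1.2).1 k).scaleConst fun h => by
        rw [hu x.2 k (((hS _ x.1.2).2.1 k).symm.trans h), Units.val_one],
      (Polynomial.natDegree_scaleConst _ _).trans ((hS _ x.1.2).2.1 k), by
        rw [Polynomial.coeff_zero_scaleConst]
        exact mul_ne_zero (u x.2 k).ne_zero (hne _ x.1.2 k)⟩
  refine Nat.card_le_card_of_injective f ?_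
  rintro ⟨g, d⟩ ⟨g', d'⟩ h
  have h1 : ∀ k, (g.1 k).scaleConst (u d k : F) = (g'.1 k).scaleConst (u d' k : F) := fun k =>
    congrArg Subtype.val (congrFun h k)
  have key : ∀ (g : S) (d : powSubgroup Fˣ m),
      ∏ k, ((g.1 k).scaleConst (u d k : F)).coeff 0 ^ ((k : ℕ) + 1) = (d : Fˣ) * c := by
    intro g d
    simp only [Polynomial.coeff_zero_scaleConst, mul_pow, Finset.prod_mul_distrib]
    rw [(hS _ g.2).2.2, ← hud d]
    simp
  have hd : d = d' := by
    refine Subtype.ext (Units.ext (mul_right_cancel₀ hc ?_))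
    rw [← key g d, ← key g' d']
    simp only [h1]
  subst hd
  exact Prod.ext (Subtype.ext (funext fun k =>
    Polynomial.scaleConst_injective (u d k).ne_zero (h1 k))) rfl

/-- The multiplicity functions of the partitions of `n`, the value at `k` counting the parts equal
to `k + 1`. -/
def partMultiplicities (n : ℕ) : Finset (Fin n → ℕ) :=
  (Fintype.piFinset fun _ : Fin n => Finset.range (n + 1)).filter
    fun m => ∑ k : Fin n, ((k : ℕ) + 1) * m k = n

theorem mem_partMultiplicities {n : ℕ} {m : Fin n → ℕ} :
    m ∈ partMultiplicities n ↔ ∑ k : Fin n, ((k : ℕ) + 1) * m k = n := by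
  refine ⟨fun h => (Finset.mem_filter.mp h).2, fun h => Finset.mem_filter.mpr
    ⟨Fintype.mem_piFinset.mpr fun k => Finset.mem_range_succ_iff.mpr ?_, h⟩⟩
  calc m k ≤ ((k : ℕ) + 1) * m k := Nat.le_mul_of_pos_left _ k.1.succ_pos
    _ ≤ ∑ k : Fin n, ((k : ℕ) + 1) * m k :=
      Finset.single_le_sum (f := fun k : Fin n => ((k : ℕ) + 1) * m k)
        (fun _ _ => Nat.zero_le _) (Finset.mem_univ k)
    _ = n := h

/-- The number of families of monic polynomials with nonzero constant coefficients whose degrees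
are the part multiplicities of a partition of `n`. -/
def countTypes (q n : ℕ) : ℕ := ∑ m ∈ partMultiplicities n, ∏ k, numMonic q (m k)

theorem numMonic_le (q m : ℕ) : numMonic q m ≤ q ^ m := by
  cases m with
  | zero => simp [numMonic]
  | succ m =>
    simp only [numMonic, Nat.succ_ne_zero, if_false, Nat.add_sub_cancel, pow_succ]
    exact Nat.mul_le_mul_left _ (Nat.sub_le _ _)

theorem sum_numMonic_mul_pow_le {q : ℕ} (hq : 2 ≤ q) (n i : ℕ) :
    ∑ m ∈ Finset.range (n + 1), (numMonic q m : ℝ) * (((q : ℝ)⁻¹) ^ (i + 2)) ^ m ≤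
      (1 - ((q : ℝ)⁻¹) ^ (i + 2)) / (1 - ((q : ℝ)⁻¹) ^ (i + 1)) := by
  have hq' : (2 : ℝ) ≤ q := by exact_mod_cast hq
  have hq0 : (q : ℝ) ≠ 0 := by positivity
  set y := (q : ℝ)⁻¹ with hy
  have hy0 : 0 < y := by positivity
  have hy1 : y < 1 := inv_lt_one_of_one_lt₀ (by linarith)
  have hr1 : y ^ (i + 1) < 1 := pow_lt_one₀ hy0.le hy1 (Nat.succ_ne_zero i)
  rw [Finset.sum_range_succ', le_div_iff₀ (by linarith)]
  have hs : ∑ m ∈ Finset.range n, (numMonic q (m + 1) : ℝ) * (y ^ (i + 2)) ^ (m + 1) =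
      (1 - y) * y ^ (i + 1) * ∑ m ∈ Finset.range n, (y ^ (i + 1)) ^ m := by
    rw [Finset.mul_sum]
    refine Finset.sum_congr rfl fun m _ => ?_
    have : (numMonic q (m + 1) : ℝ) = (q : ℝ) ^ m * (q - 1) := by
      simp [numMonic, Nat.cast_sub (by omega : 1 ≤ q)]
    have hqy : (q : ℝ) * y = 1 := mul_inv_cancel₀ hq0
    rw [this]
    calc (q : ℝ) ^ m * (q - 1) * (y ^ (i + 2)) ^ (m + 1)
        = ((q : ℝ) * y) ^ m * (q * y - y) * y ^ (i + 1) * (y ^ (i + 1)) ^ m := by ring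
      _ = _ := by rw [hqy]; ring
  have hg := geom_sum_mul_neg (y ^ (i + 1)) n
  rw [hs]
  have hpos : 0 ≤ (1 - y) * y ^ (i + 1) * (y ^ (i + 1)) ^ n :=
    mul_nonneg (mul_nonneg (by linarith) (by positivity)) (by positivity)
  have h0 : (numMonic q 0 : ℝ) = 1 := by simp [numMonic]
  calc _ = (1 - y) * y ^ (i + 1) * ((∑ m ∈ Finset.range n, (y ^ (i + 1)) ^ m) *
        (1 - y ^ (i + 1))) + (1 - y ^ (i + 1)) := by rw [h0]; ring
    _ = 1 - y ^ (i + 2) - (1 - y) * y ^ (i + 1) * (y ^ (i + 1)) ^ n := by rw [hg]; ring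
    _ ≤ _ := by linarith

theorem prod_div_pow_eq {y : ℝ} (hy0 : 0 < y) (hy1 : y < 1) (N : ℕ) :
    ∏ i : Fin N, (1 - y ^ ((i : ℕ) + 2)) / (1 - y ^ ((i : ℕ) + 1)) =
      (1 - y ^ (N + 1)) / (1 - y) := by
  have hne : ∀ i : ℕ, 1 - y ^ (i + 1) ≠ 0 := fun i =>
    (sub_pos.mpr (pow_lt_one₀ hy0.le hy1 (Nat.succ_ne_zero i))).ne'
  rw [Fin.prod_univ_eq_prod_range (fun i => (1 - y ^ (i + 2)) / (1 - y ^ (i + 1)))]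
  have := hne 0
  induction N with
  | zero => simp_all
  | succ N ih =>
    rw [Finset.prod_range_succ, ih]
    have := hne N
    field_simp

theorem countTypes_mul_le {q : ℕ} (hq : 2 ≤ q) (N : ℕ) :
    (countTypes q (N + 1) : ℝ) * (q - 1) ≤ (q : ℝ) ^ (N + 2) - q ^ (N + 1) + q ^ N - q := by
  have hq' : (2 : ℝ) ≤ q := by exact_mod_cast hq
  have hq0 : (q : ℝ) ≠ 0 := by positivity
  set y := (q : ℝ)⁻¹ with hy
  have hy0 : 0 < y := by positivity
  have hy1 : y < 1 := inv_lt_one_of_one_lt₀ (by linarith)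
  have hqy : (q : ℝ) * y = 1 := mul_inv_cancel₀ hq0
  let P := Fintype.piFinset fun _ : Fin N => Finset.range (N + 1 + 1)
  let t : (Fin N → ℕ) → ℝ := fun m => ∏ i, (numMonic q (m i) : ℝ) * (y ^ ((i : ℕ) + 2)) ^ m i
  have ht0 : ∀ m, 0 ≤ t m := fun m => Finset.prod_nonneg fun i _ => by positivity
  have htsum : ∑ m ∈ P, t m ≤ (1 - y ^ (N + 1)) / (1 - y) := by
    rw [← prod_div_pow_eq hy0 hy1 N]
    refine (Finset.prod_univ_sum (fun _ : Fin N => Finset.range (N + 1 + 1))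
      fun i m => (numMonic q m : ℝ) * (y ^ ((i : ℕ) + 2)) ^ m).symm.trans_le ?_
    exact Finset.prod_le_prod (fun i _ => Finset.sum_nonneg fun m _ => by positivity)
      fun i _ => sum_numMonic_mul_pow_le hq _ _
  have hterm : ∀ m ∈ partMultiplicities (N + 1), (∏ k, (numMonic q (m k) : ℝ)) ≤
      q ^ (N + 1) * t (Fin.tail m) - if Fin.tail m = 0 then (q : ℝ) ^ N else 0 := by
    intro m hm
    have hm := mem_partMultiplicities.mp hm
    rw [Fin.sum_univ_succ] at hm
    simp only [Fin.val_zero, zero_add, one_mul, Fin.val_succ] at hm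
    rw [Fin.prod_univ_succ]
    have ht : (q : ℝ) ^ (N + 1) * t (Fin.tail m) =
        q ^ (m 0) * ∏ k : Fin N, (numMonic q (m k.succ) : ℝ) := by
      have : ∏ i : Fin N, (y ^ ((i : ℕ) + 2)) ^ m i.succ =
          y ^ ∑ i : Fin N, ((i : ℕ) + 1 + 1) * m i.succ := by
        rw [← Finset.prod_pow_eq_pow_sum]
        exact Finset.prod_congr rfl fun i _ => (pow_mul _ _ _).symm
      simp only [t, Fin.tail, Finset.prod_mul_distrib]
      rw [this]
      conv_lhs => rw [← hm, pow_add]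
      calc _ = (q * y) ^ (∑ i : Fin N, ((i : ℕ) + 1 + 1) * m i.succ) *
            (q ^ (m 0) * ∏ k : Fin N, (numMonic q (m k.succ) : ℝ)) := by rw [mul_pow]; ring
        _ = _ := by rw [hqy, one_pow, one_mul]
    split_ifs with h
    · have h' : ∀ k : Fin N, m k.succ = 0 := fun k => congrFun h k
      have hm0 : m 0 = N + 1 := by simpa [h'] using hm
      rw [ht]
      simp only [h', hm0]
      have : (numMonic q (N + 1) : ℝ) = (q : ℝ) ^ N * (q - 1) := by
        simp [numMonic, Nat.cast_sub (by omega : 1 ≤ q)]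
      rw [this]
      simp [numMonic]
      ring_nf
      rfl
    · rw [ht, sub_zero]
      exact mul_le_mul_of_nonneg_right (by exact_mod_cast numMonic_le _ _)
        (Finset.prod_nonneg fun k _ => by positivity)
  have hc : (countTypes q (N + 1) : ℝ) ≤ q ^ (N + 1) * ∑ m ∈ P, t m - q ^ N := by
    have hinj : Set.InjOn Fin.tail (partMultiplicities (N + 1) : Set (Fin (N + 1) → ℕ)) := by
      intro m hm m' hm' h
      have hm := mem_partMultiplicities.mp hm
      have hm' := mem_partMultiplicities.mp hm'
      have h' : ∀ k : Fin N, m k.succ = m' k.succ := fun k => congrFun h k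
      rw [Fin.sum_univ_succ] at hm hm'
      simp only [h'] at hm
      refine funext fun k => Fin.cases ?_ h' k
      simp only [Fin.val_zero, zero_add, one_mul] at hm hm'
      omega
    have hsub : (partMultiplicities (N + 1)).image Fin.tail ⊆ P := by
      intro m hm
      obtain ⟨m, hm', rfl⟩ := Finset.mem_image.mp hm
      have hm := Fintype.mem_piFinset.mp (Finset.mem_filter.mp hm').1
      exact Fintype.mem_piFinset.mpr fun k => hm k.succ
    have hzero : (0 : Fin N → ℕ) ∈ (partMultiplicities (N + 1)).image Fin.tail := by
      refine Finset.mem_image.mpr ⟨Fin.cons (N + 1) 0, mem_partMultiplicities.mpr ?_, rfl⟩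
      simp [Fin.sum_univ_succ]
    calc (countTypes q (N + 1) : ℝ)
        = ∑ m ∈ partMultiplicities (N + 1), ∏ k, (numMonic q (m k) : ℝ) := by
          rw [countTypes, Nat.cast_sum]
          exact Finset.sum_congr rfl fun m _ => Nat.cast_prod _ _
      _ ≤ ∑ m ∈ partMultiplicities (N + 1), (q ^ (N + 1) * t (Fin.tail m) -
            if Fin.tail m = 0 then (q : ℝ) ^ N else 0) := Finset.sum_le_sum hterm
      _ = ∑ m ∈ (partMultiplicities (N + 1)).image Fin.tail, (q ^ (N + 1) * t m -
            if m = 0 then (q : ℝ) ^ N else 0) :=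
        (Finset.sum_image (f := fun m => (q : ℝ) ^ (N + 1) * t m -
          if m = 0 then (q : ℝ) ^ N else 0) hinj).symm
      _ = q ^ (N + 1) * ∑ m ∈ (partMultiplicities (N + 1)).image Fin.tail, t m - q ^ N := by
        rw [Finset.sum_sub_distrib, Finset.sum_ite_eq', if_pos hzero, Finset.mul_sum]
      _ ≤ _ := sub_le_sub_right (mul_le_mul_of_nonneg_left
          (Finset.sum_le_sum_of_subset_of_nonneg hsub fun m _ _ => ht0 m) (by positivity)) _
  have h1 : (0 : ℝ) < 1 - y := by linarith
  have hq1 : (q : ℝ) - 1 = q * (1 - y) := by rw [mul_sub, hqy, mul_one]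
  have hqN : (q : ℝ) ^ (N + 1) * y ^ (N + 1) = 1 := by rw [← mul_pow, hqy, one_pow]
  have htq : (∑ m ∈ P, t m) * (q - 1) ≤ (1 - y ^ (N + 1)) * q := by
    rw [le_div_iff₀ h1] at htsum
    rw [hq1]
    nlinarith
  have h2 := mul_le_mul_of_nonneg_left htq (pow_nonneg (by linarith : (0 : ℝ) ≤ q) (N + 1))
  have h3 := mul_le_mul_of_nonneg_right hc (by linarith : (0 : ℝ) ≤ q - 1)
  have h4 : (q : ℝ) ^ (N + 1) * ((1 - y ^ (N + 1)) * q) = q ^ (N + 2) - q := by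
    linear_combination -(q : ℝ) * hqN
  have h5 : ((q : ℝ) ^ (N + 1) * ∑ m ∈ P, t m - q ^ N) * (q - 1) =
      q ^ (N + 1) * ((∑ m ∈ P, t m) * (q - 1)) - q ^ (N + 1) + q ^ N := by ring
  linarith

/-- Special linear classes whose representatives have the same primary type are separated by a
quotient of the determinant group. -/
theorem card_conjClasses_le_index {F : Type*} [Field F] [Fintype F] {n : ℕ}
    {g : Fin n → F[X]} (S : Finset (ConjClasses (Matrix.SpecialLinearGroup (Fin n) F)))
    (hS : ∀ c ∈ S, (Quotient.out c : Matrix.SpecialLinearGroup (Fin n) F).1.HasPrimaryType g) :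
    S.card ≤ (powSubgroup Fˣ fun k => (g k).natDegree).index := by
  obtain rfl | ⟨c₀, hc₀⟩ := S.eq_empty_or_nonempty
  · simp
  set D := powSubgroup Fˣ fun k => (g k).natDegree with hD
  let A (c : ConjClasses (Matrix.SpecialLinearGroup (Fin n) F)) : Matrix (Fin n) (Fin n) F :=
    (Quotient.out c : Matrix.SpecialLinearGroup (Fin n) F).1
  have hcomm : ∀ d ∈ D, ∃ Q : GL (Fin n) F, (Q : Matrix (Fin n) (Fin n) F) * A c₀ = A c₀ * Q ∧
      Matrix.GeneralLinearGroup.det Q = d := by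
    let Z : Subgroup (GL (Fin n) F) :=
      { carrier := {Q | (Q : Matrix (Fin n) (Fin n) F) * A c₀ = A c₀ * Q}
        one_mem' := by simp
        mul_mem' := by
          intro P Q (hP : _ = _) (hQ : _ = _)
          show _ = _
          rw [Units.val_mul, mul_assoc, hQ, ← mul_assoc, hP, mul_assoc]
        inv_mem' := by
          intro P (hP : _ = _)
          exact ((Units.inv_mul_eq_iff_eq_mul P).mpr (by
            rw [← mul_assoc, hP, mul_assoc, Units.mul_inv, mul_one])) }
    have hle : D ≤ Z.map Matrix.GeneralLinearGroup.det := by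
      refine iSup₂_le fun k hk => ?_
      rintro _ ⟨a, rfl⟩
      obtain ⟨P, hP, hd⟩ := (hS c₀ hc₀).exists_commute_det_eq hk a
      exact ⟨P, hP, hd⟩
    exact fun d hd => hle hd
  choose P hP using fun c : S => (hS c₀ hc₀).exists_GL (hS c c.2)
  rw [← Nat.card_eq_finsetCard, Subgroup.index]
  refine Nat.card_le_card_of_injective
    (fun c => (Matrix.GeneralLinearGroup.det (P c) : Fˣ ⧸ D)) fun c c' h => Subtype.ext ?_
  obtain ⟨Q, hQ, hd⟩ := hcomm _ (QuotientGroup.eq.mp h)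
  have hdet : Matrix.GeneralLinearGroup.det (P c * Q * (P c')⁻¹) = 1 := by
    simp [hd]
  have hdet' : (P c * Q * (P c')⁻¹ : GL (Fin n) F).1.det = 1 := congrArg Units.val hdet
  have hconj : (P c * Q * (P c')⁻¹ : GL (Fin n) F).1 * A c' =
      A c * (P c * Q * (P c')⁻¹ : GL (Fin n) F).1 := by
    have h1 : ((P c')⁻¹ : GL (Fin n) F).1 * A c' = A c₀ * ((P c')⁻¹ : GL (Fin n) F).1 :=
      (Units.inv_mul_eq_iff_eq_mul _).mpr (by
        rw [← mul_assoc, hP, mul_assoc, Units.mul_inv, mul_one])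
    simp only [Units.val_mul]
    rw [mul_assoc, h1, ← mul_assoc, mul_assoc _ Q.1, hQ, ← mul_assoc, hP]
    simp only [mul_assoc]
    rfl
  have hcc : IsConj (Quotient.out c'.1) (Quotient.out c.1) := by
    refine isConj_iff.mpr ⟨⟨_, hdet'⟩, mul_inv_eq_of_eq_mul (Subtype.ext hconj)⟩
  have := ConjClasses.mk_eq_mk_iff_isConj.mpr hcc
  exact (Quotient.out_eq c.1).symm.trans (this.symm.trans (Quotient.out_eq c'.1))

theorem card_sub_one_mul_card_conjClasses_le {F : Type*} [Field F] [Fintype F] {n : ℕ} :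
    (Fintype.card F - 1) * Nat.card (ConjClasses (Matrix.SpecialLinearGroup (Fin n) F)) ≤
      ∑ m ∈ partMultiplicities n,
        (powSubgroup Fˣ m).index ^ 2 * ∏ k, numMonic (Fintype.card F) (m k) := by
  classical
  let V := ConjClasses (Matrix.SpecialLinearGroup (Fin n) F)
  have : Finite V := Quotient.finite _
  have := Fintype.ofFinite V
  choose g hg using fun c : V =>
    (Quotient.out c : Matrix.SpecialLinearGroup (Fin n) F).1.exists_hasPrimaryType
  have hmaps : ∀ c ∈ (Finset.univ : Finset V), (fun k => (g c k).natDegree) ∈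
      partMultiplicities n := fun c _ => mem_partMultiplicities.mpr (hg c).sum_natDegree
  rw [Nat.card_eq_fintype_card (α := V), ← Finset.card_univ (α := V),
    Finset.card_eq_sum_card_fiberwise hmaps,
    Finset.mul_sum]
  refine Finset.sum_le_sum fun m _ => ?_
  set S := Finset.univ.filter fun c : V => (fun k => (g c k).natDegree) = m with hS
  have hmem : ∀ c ∈ S, ∀ k, (g c k).natDegree = m k := fun c hc k =>
    congrFun (Finset.mem_filter.mp hc).2 k
  have h1 : S.card ≤ (powSubgroup Fˣ m).index * (S.image g).card := by
    refine Finset.card_le_mul_card_image S _ fun h hh => ?_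
    obtain ⟨c, hc, rfl⟩ := Finset.mem_image.mp hh
    rw [← (Finset.mem_filter.mp hc).2]
    exact card_conjClasses_le_index _ fun c' hc' => (Finset.mem_filter.mp hc').2 ▸ hg c'
  have h2 := card_mul_card_powSubgroup_le (m := m) (c := (-1) ^ n)
    (pow_ne_zero n (neg_ne_zero.mpr one_ne_zero)) (S.image g) (by
      intro h hh
      obtain ⟨c, hc, rfl⟩ := Finset.mem_image.mp hh
      refine ⟨(hg c).monic, hmem c hc, ?_⟩
      rw [(hg c).prod_coeff_zero, (Quotient.out c : Matrix.SpecialLinearGroup (Fin n) F).2,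
        mul_one])
  have h3 := (powSubgroup Fˣ m).index_mul_card
  rw [Nat.card_units, Nat.card_eq_fintype_card (α := F)] at h3
  calc (Fintype.card F - 1) * S.card
      ≤ (Fintype.card F - 1) * ((powSubgroup Fˣ m).index * (S.image g).card) :=
        Nat.mul_le_mul_left _ h1
    _ = (powSubgroup Fˣ m).index ^ 2 * ((S.image g).card * Nat.card (powSubgroup Fˣ m)) := by
        rw [← h3]; ring
    _ ≤ _ := Nat.mul_le_mul_left _ h2

theorem sum_partMultiplicities_dvd_le (q : ℕ) {n d : ℕ} (hd : d ∣ n) (hd0 : d ≠ 0) :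
    ∑ m ∈ partMultiplicities n with ∀ k : Fin n, m k ≠ 0 → d ∣ (k : ℕ) + 1,
      ∏ k, numMonic q (m k) ≤ countTypes q (n / d) := by
  obtain ⟨t, rfl⟩ := hd
  rw [Nat.mul_div_cancel_left _ (Nat.pos_of_ne_zero hd0)]
  have hpos : ∀ i : ℕ, d * (i + 1) - 1 + 1 = d * (i + 1) := fun i =>
    Nat.sub_add_cancel (Nat.mul_pos (Nat.pos_of_ne_zero hd0) i.succ_pos)
  let e : Fin t → Fin (d * t) := fun i =>
    ⟨d * (i + 1) - 1, (hpos i).le.trans (Nat.mul_le_mul_left d i.2)⟩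
  have he : ∀ i, (e i : ℕ) + 1 = d * (i + 1) := fun i => hpos i
  have heinj : Function.Injective e := by
    intro i j h
    have h' := (he i).symm.trans ((congrArg (fun k : Fin (d * t) => (k : ℕ) + 1) h).trans (he j))
    exact Fin.ext (Nat.succ_injective (Nat.eq_of_mul_eq_mul_left (Nat.pos_of_ne_zero hd0) h'))
  have hrange : ∀ k : Fin (d * t), d ∣ (k : ℕ) + 1 → k ∈ Set.range e := by
    rintro k ⟨s, hs⟩
    cases s with
    | zero => omega
    | succ s =>
      have hst : s < t :=
        Nat.le_of_mul_le_mul_left (hs ▸ k.2 : d * (s + 1) ≤ d * t) (Nat.pos_of_ne_zero hd0)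
      exact ⟨⟨s, hst⟩, Fin.ext (Nat.succ_injective ((he _).trans hs.symm))⟩
  set S := (partMultiplicities (d * t)).filter fun m => ∀ k : Fin (d * t), m k ≠ 0 → d ∣ (k : ℕ) + 1
    with hS
  have hout : ∀ m ∈ S, ∀ k ∉ Set.range e, m k = 0 := fun m hm k hk => by
    by_contra h
    exact hk (hrange k ((Finset.mem_filter.mp hm).2 k h))
  have hinj : Set.InjOn (fun m : Fin (d * t) → ℕ => m ∘ e) S := by
    intro m hm m' hm' h
    refine funext fun k => ?_
    by_cases hk : k ∈ Set.range e
    · obtain ⟨i, rfl⟩ := hk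
      exact congrFun h i
    · rw [hout m hm k hk, hout m' hm' k hk]
  have hsub : S.image (fun m => m ∘ e) ⊆ partMultiplicities t := by
    intro m' hm'
    obtain ⟨m, hm, rfl⟩ := Finset.mem_image.mp hm'
    have h := mem_partMultiplicities.mp (Finset.mem_filter.mp hm).1
    rw [← Fintype.sum_of_injective e heinj (fun i => d * (((i : ℕ) + 1) * m (e i))) _
      (fun k hk => by rw [hout m hm k hk, mul_zero])
      (fun i => by rw [he, mul_assoc]), ← Finset.mul_sum] at h
    exact mem_partMultiplicities.mpr (Nat.eq_of_mul_eq_mul_left (Nat.pos_of_ne_zero hd0) h)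
  calc ∑ m ∈ S, ∏ k, numMonic q (m k) = ∑ m ∈ S, ∏ i, numMonic q ((m ∘ e) i) := by
        refine Finset.sum_congr rfl fun m hm => (Fintype.prod_of_injective e heinj _ _
          (fun k hk => ?_) fun i => rfl).symm
        rw [hout m hm k hk, numMonic, if_pos rfl]
    _ = ∑ m ∈ S.image (fun m => m ∘ e), ∏ i, numMonic q (m i) :=
      (Finset.sum_image (f := fun m => ∏ i, numMonic q (m i)) hinj).symm
    _ ≤ _ := Finset.sum_le_sum_of_subset hsub

theorem sum_sq_mul_prod_numMonic_le {q n : ℕ} (hq : 2 ≤ q) (hn : n ≠ 0) {f : (Fin n → ℕ) → ℕ}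
    (hf : ∀ m, f m ∣ q - 1) (hf' : ∀ m (k : Fin n), m k ≠ 0 → f m ∣ (k : ℕ) + 1) :
    ∑ m ∈ partMultiplicities n, f m ^ 2 * ∏ k, numMonic q (m k) ≤ countTypes q n +
      ∑ d ∈ n.divisors with 2 ≤ d ∧ d < q, (d ^ 2 - 1) * countTypes q (n / d) := by
  have hterm : ∀ m ∈ partMultiplicities n, f m ^ 2 * ∏ k, numMonic q (m k) ≤
      ∏ k, numMonic q (m k) + ∑ d ∈ n.divisors with 2 ≤ d ∧ d < q,
        if ∀ k : Fin n, m k ≠ 0 → d ∣ (k : ℕ) + 1 then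
          (d ^ 2 - 1) * ∏ k, numMonic q (m k) else 0 := by
    intro m hm
    have hfpos : 0 < f m := Nat.pos_of_dvd_of_pos (hf m) (by omega)
    have hsplit : f m ^ 2 * ∏ k, numMonic q (m k) =
        ∏ k, numMonic q (m k) + (f m ^ 2 - 1) * ∏ k, numMonic q (m k) := by
      conv_lhs => rw [← Nat.sub_add_cancel (Nat.pow_pos (n := 2) hfpos)]
      ring
    rw [hsplit]
    refine Nat.add_le_add_left ?_ _
    rcases Nat.lt_or_ge 1 (f m) with h1 | h1
    · have hmem : f m ∈ n.divisors.filter fun d => 2 ≤ d ∧ d < q := by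
        have hle := Nat.le_of_dvd (by omega) (hf m)
        refine Finset.mem_filter.mpr ⟨Nat.mem_divisors.mpr ⟨?_, hn⟩, h1, by omega⟩
        rw [← mem_partMultiplicities.mp hm]
        refine Finset.dvd_sum fun k _ => ?_
        by_cases hk : m k = 0
        · simp [hk]
        · exact (hf' m k hk).mul_right _
      refine le_trans ?_ (Finset.single_le_sum (fun _ _ => Nat.zero_le _) hmem)
      rw [if_pos (hf' m)]
    · have : f m = 1 := by omega
      simp [this]
  refine (Finset.sum_le_sum hterm).trans ?_
  rw [Finset.sum_add_distrib, Finset.sum_comm]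
  refine Nat.add_le_add_left (Finset.sum_le_sum fun d hd => ?_) _
  obtain ⟨hd, h2, -⟩ := Finset.mem_filter.mp hd
  rw [← Finset.sum_filter, ← Finset.mul_sum]
  exact Nat.mul_le_mul_left _
    (sum_partMultiplicities_dvd_le q (Nat.dvd_of_mem_divisors hd) (by omega))

theorem countTypes_add_sum_le {q n : ℕ} (hq : 2 ≤ q) (hn : 2 ≤ n) :
    (countTypes q n : ℝ) + ∑ d ∈ n.divisors with 2 ≤ d ∧ d < q,
      ((d ^ 2 - 1 : ℕ) : ℝ) * countTypes q (n / d) ≤ (q : ℝ) ^ n + 3 * (q : ℝ) ^ (n - 1) := by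
  have hq' : (2 : ℝ) ≤ q := by exact_mod_cast hq
  have hq1 : (0 : ℝ) < q - 1 := by linarith
  have c1 : (countTypes q 1 : ℝ) ≤ q - 1 := by
    have := countTypes_mul_le hq 0
    refine le_of_mul_le_mul_right (this.trans ?_) hq1
    ring_nf; rfl
  have c2 : (countTypes q 2 : ℝ) ≤ (q : ℝ) ^ 2 := by
    have := countTypes_mul_le hq 1
    refine le_of_mul_le_mul_right (this.trans ?_) hq1
    ring_nf; rfl
  have hsub : ∀ S : Finset ℕ, n.divisors.erase 1 ⊆ S →
      ∑ d ∈ n.divisors with 2 ≤ d ∧ d < q, ((d ^ 2 - 1 : ℕ) : ℝ) * countTypes q (n / d) ≤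
        ∑ d ∈ S, ((d ^ 2 - 1 : ℕ) : ℝ) * countTypes q (n / d) := by
    intro S hS
    refine Finset.sum_le_sum_of_subset_of_nonneg (fun d hd => hS ?_) fun d _ _ => by positivity
    obtain ⟨hd, h2, -⟩ := Finset.mem_filter.mp hd
    exact Finset.mem_erase.mpr ⟨by omega, hd⟩
  rcases Nat.lt_or_ge n 6 with h6 | h6
  · interval_cases n
    · have h := hsub {2} (by decide)
      norm_num at h ⊢
      linarith
    · have c3 : (countTypes q 3 : ℝ) ≤ (q : ℝ) ^ 3 + q :=
        le_of_mul_le_mul_right ((countTypes_mul_le hq 2).trans (by ring_nf; rfl)) hq1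
      have h := hsub {3} (by decide)
      norm_num at h ⊢
      nlinarith [sq_nonneg ((q : ℝ) - 2)]
    · have c4 : (countTypes q 4 : ℝ) ≤ (q : ℝ) ^ 4 + q ^ 2 + q :=
        le_of_mul_le_mul_right ((countTypes_mul_le hq 3).trans (by ring_nf; rfl)) hq1
      rcases Nat.lt_or_ge q 3 with h3 | h3
      · rw [Finset.sum_eq_zero fun d hd => absurd (Finset.mem_filter.mp hd).2 (by omega)]
        norm_num
        nlinarith [mul_nonneg (sq_nonneg (q : ℝ)) (sub_nonneg.mpr hq')]
      · have h := hsub {2, 4} (by decide)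
        have h3' : (3 : ℝ) ≤ q := by exact_mod_cast h3
        norm_num at h ⊢
        nlinarith [mul_nonneg (sq_nonneg (q : ℝ)) (sub_nonneg.mpr h3'), sq_nonneg ((q : ℝ) - 3)]
    · have c5 : (countTypes q 5 : ℝ) ≤ (q : ℝ) ^ 5 + q ^ 3 + q ^ 2 + q :=
        le_of_mul_le_mul_right ((countTypes_mul_le hq 4).trans (by ring_nf; rfl)) hq1
      have h := hsub {5} (by decide)
      rw [Finset.sum_singleton, Nat.div_self (by omega)] at h
      norm_num only at h ⊢
      have h4 : 2 * (q : ℝ) ^ 3 ≤ q ^ 4 := by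
        nlinarith [mul_nonneg (pow_nonneg (by linarith : (0 : ℝ) ≤ q) 3) (sub_nonneg.mpr hq')]
      nlinarith [mul_nonneg (sq_nonneg (q : ℝ)) (sub_nonneg.mpr hq'), sq_nonneg ((q : ℝ) - 2)]
  have hc : ∀ m, m ≠ 0 → (countTypes q m : ℝ) ≤ (q : ℝ) ^ m + (q : ℝ) ^ (m - 1) := by
    intro m hm
    obtain ⟨N, rfl⟩ := Nat.exists_eq_succ_of_ne_zero hm
    refine le_of_mul_le_mul_right ((countTypes_mul_le hq N).trans ?_) hq1
    have hp : (1 : ℝ) ≤ q ^ N := one_le_pow₀ (by linarith)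
    simp only [Nat.succ_eq_add_one, Nat.add_sub_cancel, pow_succ]
    nlinarith
  have hsum : ∑ d ∈ n.divisors with 2 ≤ d ∧ d < q,
      ((d ^ 2 - 1 : ℕ) : ℝ) * countTypes q (n / d) ≤ 2 * (q : ℝ) ^ (n - 1) := by
    calc ∑ d ∈ n.divisors with 2 ≤ d ∧ d < q, ((d ^ 2 - 1 : ℕ) : ℝ) * countTypes q (n / d)
        ≤ ∑ d ∈ n.divisors with 2 ≤ d ∧ d < q, 2 * q * (q - 1) * (q : ℝ) ^ (n / d) := by
          refine Finset.sum_le_sum fun d hd => ?_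
          obtain ⟨hd, h2, hdq⟩ := Finset.mem_filter.mp hd
          have hm : n / d ≠ 0 :=
            (Nat.div_pos (Nat.divisor_le hd) (by omega)).ne'
          have h1 : ((d ^ 2 - 1 : ℕ) : ℝ) ≤ q * (q - 1) := by
            rw [Nat.cast_sub (Nat.one_le_pow _ _ (by omega))]
            have : (d : ℝ) + 1 ≤ q := by exact_mod_cast hdq
            push_cast
            nlinarith
          have h2 : (countTypes q (n / d) : ℝ) ≤ 2 * (q : ℝ) ^ (n / d) := by
            have := hc _ hm
            have := pow_le_pow_right₀ (by linarith : (1 : ℝ) ≤ q) (Nat.sub_le (n / d) 1)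
            linarith
          refine (mul_le_mul h1 h2 (by positivity) (by nlinarith)).trans_eq (by ring)
      _ = 2 * q * (q - 1) * ∑ m ∈ (n.divisors.filter fun d => 2 ≤ d ∧ d < q).image (n / ·),
            (q : ℝ) ^ m := by
          rw [← Finset.mul_sum, Finset.sum_image]
          intro d hd d' hd' h
          have hd := (Finset.mem_filter.mp hd).1
          have hd' := (Finset.mem_filter.mp hd').1
          exact (Nat.div_eq_iff_eq_of_dvd_dvd (by omega) (Nat.dvd_of_mem_divisors hd)
            (Nat.dvd_of_mem_divisors hd')).mp h
      _ ≤ 2 * q * (q - 1) * ∑ m ∈ Finset.range (n / 2 + 1), (q : ℝ) ^ m := by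
          refine mul_le_mul_of_nonneg_left (Finset.sum_le_sum_of_subset_of_nonneg ?_
            fun _ _ _ => by positivity) (by positivity)
          intro m hm
          obtain ⟨d, hd, rfl⟩ := Finset.mem_image.mp hm
          exact Finset.mem_range.mpr (Nat.lt_succ_of_le
            (Nat.div_le_div_left (Finset.mem_filter.mp hd).2.1 two_pos))
      _ = 2 * q * ((q : ℝ) ^ (n / 2 + 1) - 1) := by
          rw [← geom_sum_mul]
          ring
      _ ≤ 2 * (q : ℝ) ^ (n / 2 + 2) := by
          rw [pow_succ (q : ℝ) (n / 2 + 1)]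
          linarith
      _ ≤ _ := mul_le_mul_of_nonneg_left
          (pow_le_pow_right₀ (by linarith) (by omega)) two_pos.le
  linarith [hc n (by omega)]

/-- Corollary 3.8(1): for `SL(n,q) ⊆ H ⊆ GL(n,q)` of index `j` in `GL(n,q)`,
`q^{n-1}(q-1)/j ≤ k(H) ≤ (q-1) k(SL(n,q))/j ≤ (q^n + 3q^{n-1})/j`. -/
theorem stmt_8 (F : Type*) [Field F] [Fintype F] (q n : ℕ)
    (hq : Fintype.card F = q) (hn : 2 ≤ n)
    (H : Subgroup (Matrix.GeneralLinearGroup (Fin n) F))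
    (hH : ∀ g : Matrix.GeneralLinearGroup (Fin n) F,
      Matrix.det (g : Matrix (Fin n) (Fin n) F) = 1 → g ∈ H) :
    (q : ℝ) ^ (n - 1) * ((q : ℝ) - 1) / (H.index : ℝ) ≤ (Nat.card (ConjClasses H) : ℝ) ∧
    (Nat.card (ConjClasses H) : ℝ) ≤
      ((q : ℝ) - 1) * (Nat.card (ConjClasses (Matrix.SpecialLinearGroup (Fin n) F)) : ℝ)
        / (H.index : ℝ) ∧
    ((q : ℝ) - 1) * (Nat.card (ConjClasses (Matrix.SpecialLinearGroup (Fin n) F)) : ℝ) ≤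
      (q : ℝ) ^ n + 3 * (q : ℝ) ^ (n - 1) := by
  subst hq
  have hq : 2 ≤ Fintype.card F := Fintype.one_lt_card
  have hj : (0 : ℝ) < H.index := by
    exact_mod_cast Nat.pos_of_ne_zero H.index_ne_zero_of_finite
  have hcast : ((Fintype.card F : ℝ) - 1) = ((Fintype.card F - 1 : ℕ) : ℝ) := by
    rw [Nat.cast_sub (by omega), Nat.cast_one]
  rw [hcast, div_le_iff₀ hj, le_div_iff₀ hj]
  refine ⟨?_, ?_, ?_⟩
  · exact_mod_cast le_index_mul_card_conjClasses (by omega) H hH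
  · exact_mod_cast index_mul_card_conjClasses_le (by omega) H hH
  refine le_trans ?_ (countTypes_add_sum_le hq hn)
  have hdvd : ∀ m : Fin n → ℕ, (powSubgroup Fˣ m).index ∣ Fintype.card F - 1 := fun m => by
    rw [← Nat.card_eq_fintype_card, ← Nat.card_units]
    exact (powSubgroup Fˣ m).index_dvd_card
  exact_mod_cast card_sub_one_mul_card_conjClasses_le.trans
    (sum_sq_mul_prod_numMonic_le hq (by omega) hdvd fun m k hk => powSubgroup_index_dvd hk)
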